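/- Let D be a weakly locally finite division ring with center K and let n be a positive integer. Then for every finite subset S of the matrix ring M_n(D), there exists a K-subalgebra B of M_n(D) containing S such that B is a simple ring that is finite-dimensional over its own center (i.e., B is a finite-dimensional central simple algebra over some field). -/

import Mathlib

/-- Finite generation as a module passes to surjective images, over the centre of the image. -/
theorem moduleFinite_center_of_surjective {Z A B : Type*} [CommRing Z] [Ring A] [Ring B]
    [Algebra Z A] [Module.Finite Z A] (f : A →+* B) (hf : Function.Surjective f) :
    Module.Finite (Subring.center B) B := by
  obtain ⟨s, hs⟩ := (Module.Finite.fg_top : (⊤ : Submodule Z A).FG)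
  classical
  refine ⟨⟨s.image f, ?_⟩⟩
  rw [eq_top_iff]
  rintro b -
  obtain ⟨a, rfl⟩ := hf b
  have ha : a ∈ Submodule.span Z (s : Set A) := hs ▸ Submodule.mem_top
  induction ha using Submodule.span_induction with
  | mem x hx => exact Submodule.subset_span (by simpa using ⟨x, hx, rfl⟩)
  | zero => simp
  | add x y _ _ hx hy => simpa using add_mem hx hy
  | smul z x _ hx =>
    have hz : f (algebraMap Z A z) ∈ Subring.center B := by
      rw [Subring.mem_center_iff]
      intro b
      obtain ⟨a, rfl⟩ := hf b
      rw [← map_mul, ← map_mul, Algebra.commutes]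
    rw [Algebra.smul_def, map_mul]
    exact Submodule.smul_mem _ (⟨_, hz⟩ : Subring.center B) hx

/-- In a division algebra, a finite-dimensional subalgebra is closed under inversion. -/
theorem Subalgebra.inv_mem_of_finite {F L : Type*} [Field F] [DivisionRing L] [Algebra F L]
    (W : Subalgebra F L) [Module.Finite F W] {x : L} (hx : x ∈ W) : x⁻¹ ∈ W := by
  rcases eq_or_ne x 0 with rfl | h0
  · simp
  obtain ⟨y, hy⟩ := FiniteDimensional.exists_mul_eq_one F (x := (⟨x, hx⟩ : W))
    (fun h => h0 (congrArg Subtype.val h))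
  rw [inv_eq_of_mul_eq_one_right (congrArg Subtype.val hy : x * y = 1)]
  exact y.2

/-- If `L` is generated as a division ring by its centre and the image of a division ring that is
finite-dimensional over its centre, and the map preserves centres, then `L` is finite-dimensional
over its centre. -/
theorem moduleFinite_center_of_generated {D L : Type*} [DivisionRing D] [DivisionRing L]
    [Module.Finite (Subring.center D) D] (i : D →+* L)
    (i_center : ∀ c ∈ Subring.center D, i c ∈ Subring.center L)
    (h : ∀ W : Subfield L, (∀ x, i x ∈ W) → (∀ c ∈ Subring.center L, c ∈ W) → W = ⊤) :
    Module.Finite (Subring.center L) L := by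
  let W : Subalgebra (Subring.center L) L := Algebra.adjoin _ (i.range : Set L)
  have hW : Subalgebra.toSubmodule W = Submodule.span (Subring.center L) (i.range : Set L) := by
    apply Algebra.adjoin_eq_span_of_subset
    rw [show Submonoid.closure (i.range : Set L) = i.range.toSubmonoid from
      Submonoid.closure_eq i.range.toSubmonoid]
    exact Submodule.subset_span
  have W_fg : (Subalgebra.toSubmodule W).FG := by
    obtain ⟨s, hs⟩ := (Module.Finite.fg_top : (⊤ : Submodule (Subring.center D) D).FG)
    classical
    rw [hW]
    refine ⟨s.image i, le_antisymm (Submodule.span_mono ?_) (Submodule.span_le.2 ?_)⟩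
    · rintro _ h
      obtain ⟨x, -, rfl⟩ := Finset.mem_image.1 h
      exact ⟨x, rfl⟩
    · rintro _ ⟨x, rfl⟩
      have hx : x ∈ Submodule.span (Subring.center D) (s : Set D) := hs ▸ Submodule.mem_top
      induction hx using Submodule.span_induction with
      | mem x hx => exact Submodule.subset_span (by simpa using ⟨x, hx, rfl⟩)
      | zero => simp
      | add x y _ _ hx hy => simpa using add_mem hx hy
      | smul c x _ hx =>
        rw [Subring.smul_def, smul_eq_mul, map_mul]
        exact Submodule.smul_mem _ (⟨_, i_center c c.2⟩ : Subring.center L) hx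
  have : Module.Finite (Subring.center L) W := Module.Finite.iff_fg.2 W_fg
  let V : Subfield L :=
    { W.toSubring with inv_mem' := fun _ hx => W.inv_mem_of_finite hx }
  have hV : V = ⊤ := h V (fun x => Algebra.subset_adjoin ⟨x, rfl⟩)
    fun c hc => W.algebraMap_mem ⟨c, hc⟩
  have hW_top (y : L) : y ∈ W := by
    have : y ∈ V := hV ▸ Subfield.mem_top y
    exact this
  exact Module.Finite.of_surjective W.val.toLinearMap fun y => ⟨⟨y, hW_top y⟩, rfl⟩

/-- Adjoining the centre to a division subring that is finite-dimensional over its centre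
preserves this property. -/
theorem Subfield.moduleFinite_center_closure_union_center {D : Type*} [DivisionRing D]
    (S : Set D) [Module.Finite (Subring.center (closure S)) (closure S)] :
    Module.Finite (Subring.center (closure (S ∪ Subring.center D)))
      (closure (S ∪ Subring.center D)) := by
  refine moduleFinite_center_of_generated
    (inclusion (closure_mono Set.subset_union_left)) ?_ ?_
  · rintro ⟨c, hc_mem⟩ hc
    have hcS (y : D) (hy : y ∈ S) : Commute y c :=
      congrArg Subtype.val (Subring.mem_center_iff.1 hc ⟨y, subset_closure hy⟩)
    have hcL (y : D) (hy : y ∈ closure (S ∪ Subring.center D)) : Commute y c := by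
      induction hy using closure_induction with
      | mem y hy => exact hy.elim (hcS y) fun hy => (Subring.mem_center_iff.1 hy c).symm
      | one => exact Commute.one_left c
      | add _ _ _ _ hx hy => exact hx.add_left hy
      | neg _ _ hx => exact hx.neg_left
      | inv _ _ hx => exact hx.inv_left₀
      | mul _ _ _ _ hx hy => exact hx.mul_left hy
    exact Subring.mem_center_iff.2 fun y => Subtype.ext (hcL y y.2)
  · intro W hS hK
    rw [eq_top_iff]
    rintro ⟨y, hy⟩ -
    induction hy using closure_induction with
    | mem y hy =>
      rcases hy with hy | hy
      · exact hS ⟨y, subset_closure hy⟩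
      · exact hK _ (Subring.mem_center_iff.2 fun z => Subtype.ext (Subring.mem_center_iff.1 hy z))
    | one => exact W.one_mem
    | add _ _ _ _ hx hy => exact W.add_mem hx hy
    | neg _ _ hx => exact W.neg_mem hx
    | inv _ _ hx => exact W.inv_mem hx
    | mul _ _ _ _ hx hy => exact W.mul_mem hx hy

set_option maxHeartbeats 1000000 in
set_option synthInstance.maxHeartbeats 400000 in
/-- If `D` is a weakly locally finite division ring with center `K` and
`n` a positive integer, then every finite subset of `M_n(D)` is contained in a
`K`-subalgebra `B` of `M_n(D)` which is a simple ring, finite-dimensional over its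
own center (i.e. a finite-dimensional central simple algebra over some field). -/
theorem matrix_almost_locally_fd_central_simple (D : Type*) [DivisionRing D]
    (n : ℕ) (hn : 0 < n)
    (hwlf : ∀ S : Finset D,
        Module.Finite (Subring.center (Subfield.closure (S : Set D)))
          (Subfield.closure (S : Set D))) :
    ∀ S : Finset (Matrix (Fin n) (Fin n) D),
      ∃ B : Subalgebra (Subring.center D) (Matrix (Fin n) (Fin n) D),
        (S : Set (Matrix (Fin n) (Fin n) D)) ⊆ (B : Set (Matrix (Fin n) (Fin n) D)) ∧
        IsSimpleRing B ∧ Module.Finite (Subring.center B) B := by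
  intro S
  classical
  let T : Finset D := S.biUnion fun M => Finset.univ.image fun p : Fin n × Fin n => M p.1 p.2
  let E := Subfield.closure ((T : Set D) ∪ Subring.center D)
  have := hwlf T
  have hE : Module.Finite (Subring.center E) E :=
    Subfield.moduleFinite_center_closure_union_center (T : Set D)
  let A : Subalgebra (Subring.center D) D :=
    { E.toSubring with
      algebraMap_mem' := fun c => Subfield.subset_closure (Or.inr c.2) }
  let φ : Matrix (Fin n) (Fin n) A →ₐ[Subring.center D] Matrix (Fin n) (Fin n) D :=
    A.val.mapMatrix
  have : Nonempty (Fin n) := ⟨⟨0, hn⟩⟩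
  have : IsSimpleRing A := inferInstanceAs (IsSimpleRing E)
  have : Module.Finite (Subring.center A) A := hE
  have : Module.Finite (Subring.center A) (Matrix (Fin n) (Fin n) A) :=
    inferInstanceAs (Module.Finite (Subring.center A) (Fin n → Fin n → A))
  refine ⟨φ.range, fun M hM => ?_, ?_, ?_⟩
  · have hmem (i j : Fin n) : M i j ∈ A :=
      Subfield.subset_closure (Or.inl (Finset.mem_biUnion.2
        ⟨M, hM, Finset.mem_image.2 ⟨(i, j), Finset.mem_univ _, rfl⟩⟩))
    exact ⟨Matrix.of fun i j => ⟨M i j, hmem i j⟩, rfl⟩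
  · exact IsSimpleRing.of_surjective φ.rangeRestrict.toRingHom inferInstance
      φ.rangeRestrict_surjective
  · exact moduleFinite_center_of_surjective (Z := Subring.center A) φ.rangeRestrict.toRingHom
      φ.rangeRestrict_surjective
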